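/- (Appendix Lemma on the Haar-twirled maximally entangled state) Let n, dA, dR be positive natural numbers with dA ≤ dR. For a unitary U in Matrix.unitaryGroup (Fin dR) ℂ, define the vector φ_U : Fin dA × Fin dR → ℂ by φ_U (a, r) = U r (Fin.castLE h a), where h : dA ≤ dR. Let μ be the Haar probability measure on the compact group Matrix.unitaryGroup (Fin dR) ℂ, and define T_n to be the matrix indexed by (Fin n → Fin dA × Fin dR) with entries T_n v w = ∫ (|φ_U^⊗n⟩⟨φ_U^⊗n|) v w dμ(U), where φ_U^⊗n v = ∏ i, φ_U (v i). Then there exists a positive definite matrix κ indexed by (Fin n → Fin dA) such that T_n = S * P_sym * S, where S is the positive semidefinite square root of the matrix (κ ⊠ 1) on (Fin n → Fin dA × Fin dR) with entries (κ ⊠ 1) v w = κ (fun i => (v i).1) (fun i => (w i).1) * (if (fun i => (v i).2) = (fun i => (w i).2) then 1 else 0), and P_sym is the orthogonal projection onto the symmetric subspace, with entries P_sym v w = (Fintype.card {π : Equiv.Perm (Fin n) // w = v ∘ π}) / n!. -/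

import Mathlib

open MeasureTheory Matrix
open scoped ComplexOrder

noncomputable section

/-- Outer product `|ψ⟩⟨ψ|` of a vector. -/
def outer {d : Type*} (ψ : d → ℂ) : Matrix d d ℂ :=
  Matrix.of fun x y => ψ x * (starRingEnd ℂ) (ψ y)

/-- `n`-fold tensor power of a vector: `(φ^⊗n) v = ∏ i, φ (v i)`. -/
def vecPow {d : Type*} (φ : d → ℂ) (n : ℕ) : (Fin n → d) → ℂ :=
  fun v => ∏ i, φ (v i)

/-- The `A`-side maximally entangled purification vector twisted by a unitary `U`:
`φ_U (a, r) = U r (castLE a)`. -/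
def twistedVec {dA dR : ℕ} (h : dA ≤ dR) (U : Matrix.unitaryGroup (Fin dR) ℂ) :
    Fin dA × Fin dR → ℂ :=
  fun p => (U : Matrix (Fin dR) (Fin dR) ℂ) p.2 (Fin.castLE h p.1)

/-- The matrix `κ ⊠ 1` on `n` copies of `Fin dA × Fin dR`, acting as `κ` on the
`A`-systems and as the identity on the `R`-systems. -/
def kronWithId {dA dR n : ℕ} (κ : Matrix (Fin n → Fin dA) (Fin n → Fin dA) ℂ) :
    Matrix (Fin n → Fin dA × Fin dR) (Fin n → Fin dA × Fin dR) ℂ :=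
  Matrix.of fun v w =>
    κ (fun i => (v i).1) (fun i => (w i).1) *
      (if (fun i => (v i).2) = (fun i => (w i).2) then 1 else 0)

/-- The orthogonal projection onto the symmetric subspace of `n` copies of `d`. -/
def symProj (d : Type*) [DecidableEq d] (n : ℕ) :
    Matrix (Fin n → d) (Fin n → d) ℂ :=
  Matrix.of fun v w =>
    (Fintype.card {π : Equiv.Perm (Fin n) // w = v ∘ π} : ℂ) / (n.factorial : ℂ)

section TensorPower

variable {d : Type*} {n : ℕ}

/-- The `n`-fold tensor power of a matrix. -/
def tensorPow (n : ℕ) (A : Matrix d d ℂ) : Matrix (Fin n → d) (Fin n → d) ℂ :=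
  Matrix.of fun v w => ∏ i, A (v i) (w i)

lemma tensorPow_mul [Fintype d] (A B : Matrix d d ℂ) :
    tensorPow n (A * B) = tensorPow n A * tensorPow n B := by
  ext v w
  simp only [tensorPow, Matrix.of_apply, Matrix.mul_apply, Fintype.prod_sum,
    Finset.prod_mul_distrib]

lemma tensorPow_one [DecidableEq d] : tensorPow n (1 : Matrix d d ℂ) = 1 := by
  ext v w
  simp only [tensorPow, Matrix.of_apply, Matrix.one_apply, Finset.prod_ite_zero,
    Finset.mem_univ, true_imp_iff, Finset.prod_const_one, funext_iff]

lemma tensorPow_star (A : Matrix d d ℂ) : tensorPow n (star A) = star (tensorPow n A) := by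
  ext v w
  simp [tensorPow, Matrix.star_apply]

lemma tensorPow_apply_comp (A : Matrix d d ℂ) (v w : Fin n → d) (π : Equiv.Perm (Fin n)) :
    tensorPow n A (v ∘ π) (w ∘ π) = tensorPow n A v w :=
  Equiv.prod_comp π fun i => A (v i) (w i)

lemma tensorPow_diagonal [DecidableEq d] (c : d → ℂ) :
    tensorPow n (diagonal c) = diagonal fun v => ∏ i, c (v i) := by
  ext v w
  simp only [tensorPow, Matrix.of_apply, Matrix.diagonal_apply, Finset.prod_ite_zero,
    Finset.mem_univ, true_imp_iff, funext_iff]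

variable [Fintype d] [DecidableEq d]

lemma prod_comp_eq_prod_pow_card (c : d → ℂ) (v : Fin n → d) :
    ∏ i, c (v i) = ∏ j, c j ^ Fintype.card {i // v i = j} := by
  rw [← Finset.prod_fiberwise (s := Finset.univ) (g := v)]
  refine Finset.prod_congr rfl fun j _ => ?_
  rw [Finset.prod_congr rfl (g := fun _ => c j) (by simp +contextual), Finset.prod_const,
    Fintype.card_subtype]

lemma commute_tensorPow_diagonal {Y : Matrix (Fin n → d) (Fin n → d) ℂ}
    (hY : ∀ U ∈ Matrix.unitaryGroup d ℂ, Commute Y (tensorPow n U)) (c : d → ℂ) :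
    Commute Y (tensorPow n (diagonal c)) := by
  have key : ∀ v w, Y v w ≠ 0 → ∀ j, Fintype.card {i // w i = j} = Fintype.card {i // v i = j} := by
    intro v w hvw j
    have hζ := Complex.isPrimitiveRoot_exp (n + 1) (by omega)
    set ζ := Complex.exp (2 * Real.pi * Complex.I / (n + 1 : ℕ))
    have hn : ‖ζ‖ = 1 := hζ.norm'_eq_one (by omega)
    have hU : diagonal (fun k => if k = j then ζ else 1) ∈ Matrix.unitaryGroup d ℂ := by
      rw [Matrix.mem_unitaryGroup_iff, Matrix.star_eq_conjTranspose, diagonal_conjTranspose,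
        diagonal_mul_diagonal, ← diagonal_one]
      congr 1
      ext k
      by_cases hk : k = j
      · simp [hk, Complex.mul_conj, Complex.normSq_eq_norm_sq, hn]
      · simp [hk]
    have h := congrFun (congrFun (hY _ hU).eq v) w
    rw [tensorPow_diagonal, mul_diagonal, diagonal_mul, mul_comm, mul_left_inj' hvw] at h
    simp only [Finset.prod_ite, Finset.prod_const, one_pow, mul_one,
      ← Fintype.card_subtype] at h
    refine hζ.pow_inj ?_ ?_ h <;>
    · refine lt_of_le_of_lt (Fintype.card_subtype_le _) (by simp)
  rw [tensorPow_diagonal]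
  ext v w
  rw [mul_diagonal, diagonal_mul]
  by_cases hvw : Y v w = 0
  · simp [hvw]
  · rw [mul_comm, prod_comp_eq_prod_pow_card, prod_comp_eq_prod_pow_card]
    simp only [key v w hvw]

lemma commute_tensorPow_of_isHermitian {Y : Matrix (Fin n → d) (Fin n → d) ℂ}
    (hY : ∀ U ∈ Matrix.unitaryGroup d ℂ, Commute Y (tensorPow n U)) {H : Matrix d d ℂ}
    (hH : H.IsHermitian) : Commute Y (tensorPow n H) := by
  rw [hH.spectral_theorem, Unitary.conjStarAlgAut_apply, tensorPow_mul, tensorPow_mul]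
  exact ((hY _ hH.eigenvectorUnitary.2).mul_right (commute_tensorPow_diagonal hY _)).mul_right
    (hY _ (star hH.eigenvectorUnitary).2)

lemma commute_tensorPow {Y : Matrix (Fin n → d) (Fin n → d) ℂ}
    (hY : ∀ U ∈ Matrix.unitaryGroup d ℂ, Commute Y (tensorPow n U)) (A : Matrix d d ℂ) :
    Commute Y (tensorPow n A) := by
  obtain ⟨H, K, hH, hK, rfl⟩ : ∃ H K : Matrix d d ℂ, H.IsHermitian ∧ K.IsHermitian ∧
      A = H + Complex.I • K :=
    ⟨realPart A, imaginaryPart A, (realPart A).2, (imaginaryPart A).2,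
      (realPart_add_I_smul_imaginaryPart A).symm⟩
  ext v w
  let p : Polynomial ℂ :=
    ∑ u, Polynomial.C (Y v u) *
        ∏ i, (Polynomial.C (H (u i) (w i)) + Polynomial.X * Polynomial.C (K (u i) (w i))) -
      ∑ u, (∏ i, (Polynomial.C (H (v i) (u i)) + Polynomial.X * Polynomial.C (K (v i) (u i)))) *
        Polynomial.C (Y u w)
  have hp : ∀ z : ℂ, p.eval z =
      (Y * tensorPow n (H + z • K)) v w - (tensorPow n (H + z • K) * Y) v w := by
    intro z
    simp [p, Polynomial.eval_finsetSum, Polynomial.eval_prod, Matrix.mul_apply, tensorPow, mul_comm z]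
  have hp0 : p = 0 := by
    refine Polynomial.eq_zero_of_infinite_isRoot p
      ((Set.infinite_range_of_injective Complex.ofReal_injective).mono ?_)
    rintro _ ⟨t, rfl⟩
    have hHK : (H + (t : ℂ) • K).IsHermitian :=
      hH.add (by rw [Matrix.IsHermitian, conjTranspose_smul, hK.eq]; simp)
    rw [Set.mem_ofPred_eq, Polynomial.IsRoot, hp, (commute_tensorPow_of_isHermitian hY hHK).eq,
      sub_self]
  have := hp Complex.I
  rw [hp0, Polynomial.eval_zero] at this
  exact (sub_eq_zero.mp this.symm)

/-- Ryser's formula, in the form of a polarization identity. -/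
lemma sum_signed_prod_sum (f : Fin n → Fin n → ℂ) :
    ∑ ε : Fin n → Bool, (∏ i, if ε i then (1 : ℂ) else -1) *
        ∏ k, ∑ i, (if ε i then 1 else 0) * f i k =
      ∑ π : Equiv.Perm (Fin n), ∏ k, f (π k) k := by
  simp only [Fintype.prod_sum, Finset.mul_sum, Finset.prod_mul_distrib]
  rw [Finset.sum_comm]
  have h : ∀ g : Fin n → Fin n,
      ∑ ε : Fin n → Bool, (∏ i, if ε i then (1 : ℂ) else -1) *
        ((∏ k, if ε (g k) then (1 : ℂ) else 0) * ∏ k, f (g k) k) =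
      if Function.Surjective g then ∏ k, f (g k) k else 0 := by
    intro g
    simp only [← mul_assoc, ← Finset.sum_mul]
    have h1 : ∀ ε : Fin n → Bool, (∏ k, if ε (g k) then (1 : ℂ) else 0) =
        ∏ i, (if ε i then (1 : ℂ) else 0) ^ Fintype.card {k // g k = i} := fun ε =>
      prod_comp_eq_prod_pow_card (fun i => if ε i then (1 : ℂ) else 0) g
    simp only [h1, ← Finset.prod_mul_distrib]
    rw [← Fintype.prod_sum fun i (b : Bool) => (if b then (1 : ℂ) else -1) *
      (if b then (1 : ℂ) else 0) ^ Fintype.card {k // g k = i}]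
    split_ifs with hg
    · rw [Finset.prod_eq_one, one_mul]
      intro i _
      have : Nonempty {k // g k = i} := let ⟨k, hk⟩ := hg i; ⟨⟨k, hk⟩⟩
      simp [Fintype.card_ne_zero]
    · obtain ⟨i, hi⟩ := not_forall.mp hg
      have : IsEmpty {k // g k = i} := ⟨fun k => hi ⟨k, k.2⟩⟩
      rw [Finset.prod_eq_zero (Finset.mem_univ i), zero_mul]
      simp
  simp only [h]
  symm
  refine Fintype.sum_of_injective (fun π : Equiv.Perm (Fin n) => (π : Fin n → Fin n))
    DFunLike.coe_injective _ _ ?_ ?_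
  · intro g hg
    refine if_neg fun hs => hg ⟨Equiv.ofBijective g (Finite.surjective_iff_bijective.mp hs), rfl⟩
  · intro π
    rw [if_pos π.surjective]

lemma sum_perm_apply_comm {Y : Matrix (Fin n → d) (Fin n → d) ℂ}
    (hY : ∀ U ∈ Matrix.unitaryGroup d ℂ, Commute Y (tensorPow n U)) (x y v w : Fin n → d) :
    ∑ π : Equiv.Perm (Fin n), Y v (x ∘ π) * (if w = y ∘ π then 1 else 0) =
      ∑ π : Equiv.Perm (Fin n), (if v = x ∘ π then 1 else 0) * Y (y ∘ π) w := by
  let Q : Matrix (Fin n → d) (Fin n → d) ℂ := Matrix.of fun v w =>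
    ∑ π : Equiv.Perm (Fin n), (if v = x ∘ π then 1 else 0) * (if w = y ∘ π then 1 else 0)
  have hQ : Q = ∑ ε : Fin n → Bool, (∏ i, if ε i then (1 : ℂ) else -1) •
      tensorPow n (∑ i, (if ε i then (1 : ℂ) else 0) • Matrix.single (x i) (y i) 1) := by
    ext v w
    simp only [Q, Matrix.of_apply, Matrix.sum_apply, Matrix.smul_apply, tensorPow, smul_eq_mul,
      sum_signed_prod_sum fun i k => Matrix.single (x i) (y i) (1 : ℂ) (v k) (w k)]
    refine Finset.sum_congr rfl fun π _ => ?_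
    simp only [Matrix.single_apply, Finset.prod_ite_zero, funext_iff, Finset.mem_univ,
      true_imp_iff, Finset.prod_const_one, Function.comp_apply, forall_and, eq_comm]
    rw [ite_zero_mul_ite_zero, one_mul]
  have hc : Commute Y Q := by
    rw [hQ]
    exact Commute.sum_right _ _ _ fun ε _ => (commute_tensorPow hY _).smul_right _
  have h := congrFun (congrFun hc.eq v) w
  simp only [Matrix.mul_apply, Q, Matrix.of_apply, Finset.mul_sum, Finset.sum_mul] at h
  rw [Finset.sum_comm] at h
  rw [Finset.sum_comm (s := Finset.univ (α := Fin n → d))] at h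
  convert h using 2 with π _ π _
  all_goals simp

end TensorPower

section Twirl

/-- The trace of the permutation `π` acting on `n` copies of `d`. -/
def permTrace {n : ℕ} (d : Type*) [Fintype d] [DecidableEq d]
    (π : Equiv.Perm (Fin n)) : ℂ :=
  ∑ y : Fin n → d, if y = y ∘ π then 1 else 0

variable {d : Type*} [Fintype d] [DecidableEq d] {n : ℕ}
  [MeasurableSpace (Matrix.unitaryGroup d ℂ)] (μ : Measure (Matrix.unitaryGroup d ℂ))

/-- The Haar twirl of the matrix unit `|a⟩⟨b|` on `n` copies of `d`. -/
def twirl (a b : Fin n → d) : Matrix (Fin n → d) (Fin n → d) ℂ :=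
  Matrix.of fun r s => ∫ U, tensorPow n (U : Matrix d d ℂ) r a *
    star (tensorPow n (U : Matrix d d ℂ) s b) ∂μ

lemma twirl_comp_perm (a b r s : Fin n → d) (π : Equiv.Perm (Fin n)) :
    twirl μ a (b ∘ π) r (s ∘ π) = twirl μ a b r s := by
  simp only [twirl, Matrix.of_apply, tensorPow_apply_comp]

variable [BorelSpace (Matrix.unitaryGroup d ℂ)]

lemma integrable_tensorPow_mul_star [IsFiniteMeasure μ] (a b r s : Fin n → d) :
    Integrable (fun U : Matrix.unitaryGroup d ℂ => tensorPow n (U : Matrix d d ℂ) r a *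
      star (tensorPow n (U : Matrix d d ℂ) s b)) μ := by
  have hc : ∀ v w, Continuous fun U : Matrix.unitaryGroup d ℂ =>
      tensorPow n (U : Matrix d d ℂ) v w := by
    intro v w
    simp only [tensorPow, Matrix.of_apply]
    exact continuous_finsetProd _ fun i _ => continuous_subtype_val.matrix_elem _ _
  have hb : ∀ (U : Matrix.unitaryGroup d ℂ) v w, ‖tensorPow n (U : Matrix d d ℂ) v w‖ ≤ 1 := by
    intro U v w
    rw [tensorPow, Matrix.of_apply, norm_prod]
    exact Finset.prod_le_one (fun _ _ => norm_nonneg _)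
      fun i _ => entry_norm_bound_of_unitary U.2 _ _
  refine Integrable.of_bound ((hc r a).mul (hc s b).star).aestronglyMeasurable 1
    (Filter.Eventually.of_forall fun U => ?_)
  rw [norm_mul, norm_star]
  exact mul_le_one₀ (hb U r a) (norm_nonneg _) (hb U s b)

lemma mul_twirl_mul_star [IsFiniteMeasure μ] (a b : Fin n → d)
    (A B : Matrix (Fin n → d) (Fin n → d) ℂ) (r s : Fin n → d) :
    (A * twirl μ a b * star B) r s = ∫ U, (A * tensorPow n (U : Matrix d d ℂ)) r a *
      star ((B * tensorPow n (U : Matrix d d ℂ)) s b) ∂μ := by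
  have h : ∀ U : Matrix.unitaryGroup d ℂ, (A * tensorPow n (U : Matrix d d ℂ)) r a *
      star ((B * tensorPow n (U : Matrix d d ℂ)) s b) =
      ∑ q, ∑ p, A r p * star (B s q) * (tensorPow n (U : Matrix d d ℂ) p a *
        star (tensorPow n (U : Matrix d d ℂ) q b)) := by
    intro U
    rw [Finset.sum_comm]
    simp only [Matrix.mul_apply, star_sum, Finset.sum_mul_sum, star_mul']
    exact Finset.sum_congr rfl fun p _ => Finset.sum_congr rfl fun q _ => by ring
  have hi : ∀ p q, Integrable (fun U : Matrix.unitaryGroup d ℂ => A r p * star (B s q) *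
      (tensorPow n (U : Matrix d d ℂ) p a * star (tensorPow n (U : Matrix d d ℂ) q b))) μ :=
    fun p q => (integrable_tensorPow_mul_star μ a b p q).const_mul _
  simp only [h]
  rw [integral_finsetSum _ fun q _ => integrable_finsetSum _ fun p _ => hi p q]
  simp only [integral_finsetSum _ fun p _ => hi p _, integral_const_mul]
  simp only [Matrix.mul_apply, twirl, Matrix.of_apply, Matrix.star_apply, Finset.sum_mul]
  exact Finset.sum_congr rfl fun q _ => Finset.sum_congr rfl fun p _ => by ring

lemma commute_twirl [μ.IsMulLeftInvariant] [IsFiniteMeasure μ] (a b : Fin n → d)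
    (V : Matrix d d ℂ) (hV : V ∈ Matrix.unitaryGroup d ℂ) :
    Commute (twirl μ a b) (tensorPow n V) := by
  have h : tensorPow n V * twirl μ a b * star (tensorPow n V) = twirl μ a b := by
    ext r s
    rw [mul_twirl_mul_star, twirl, Matrix.of_apply]
    simp only [← tensorPow_mul]
    exact integral_mul_left_eq_self (fun U : Matrix.unitaryGroup d ℂ =>
      tensorPow n (U : Matrix d d ℂ) r a * star (tensorPow n (U : Matrix d d ℂ) s b)) ⟨V, hV⟩
  have h1 : star (tensorPow n V) * tensorPow n V = 1 := by
    rw [← tensorPow_star, ← tensorPow_mul, Matrix.mem_unitaryGroup_iff'.mp hV, tensorPow_one]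
  change twirl μ a b * tensorPow n V = tensorPow n V * twirl μ a b
  nth_rewrite 1 [← h]
  rw [mul_assoc, h1, mul_one]

lemma sum_twirl_comp_perm [IsProbabilityMeasure μ] (a b : Fin n → d) (π : Equiv.Perm (Fin n)) :
    ∑ y, twirl μ a b (y ∘ π) y = if b ∘ π = a then 1 else 0 := by
  have h : ∀ U : Matrix.unitaryGroup d ℂ, ∑ y, tensorPow n (U : Matrix d d ℂ) (y ∘ π) a *
      star (tensorPow n (U : Matrix d d ℂ) y b) = if b ∘ π = a then 1 else 0 := by
    intro U
    have h1 : star (tensorPow n (U : Matrix d d ℂ)) * tensorPow n (U : Matrix d d ℂ) = 1 := by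
      rw [← tensorPow_star, ← tensorPow_mul, Unitary.coe_star_mul_self, tensorPow_one]
    have h2 := congrFun (congrFun h1 (b ∘ π)) a
    rw [Matrix.mul_apply, Matrix.one_apply,
      ← Equiv.sum_comp (Equiv.arrowCongr π.symm (Equiv.refl d))] at h2
    rw [← h2]
    refine Finset.sum_congr rfl fun y _ => ?_
    rw [mul_comm, Matrix.star_apply]
    change star (tensorPow n (U : Matrix d d ℂ) y b) * _ =
      star (tensorPow n (U : Matrix d d ℂ) (y ∘ π) (b ∘ π)) * _
    rw [tensorPow_apply_comp]
    rfl
  simp only [twirl, Matrix.of_apply]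
  rw [← integral_finsetSum _ fun y _ => integrable_tensorPow_mul_star μ a b _ _]
  simp only [h, integral_const, probReal_univ, one_smul]

lemma sum_permTrace_mul_twirl [μ.IsMulLeftInvariant] [IsProbabilityMeasure μ]
    (a b v x : Fin n → d) :
    ∑ π : Equiv.Perm (Fin n), permTrace d π * twirl μ a b v (x ∘ π) =
      ∑ π : Equiv.Perm (Fin n), (if v = x ∘ π then 1 else 0) * (if b ∘ π = a then 1 else 0) := by
  have h := Finset.sum_congr (rfl : (Finset.univ : Finset (Fin n → d)) = Finset.univ) fun y _ =>
    sum_perm_apply_comm (commute_twirl μ a b) x y v y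
  rw [Finset.sum_comm, Finset.sum_comm (s := Finset.univ (α := Fin n → d))] at h
  simp only [← Finset.mul_sum, sum_twirl_comp_perm] at h
  simpa only [permTrace, mul_comm (twirl μ a b v _)] using h

end Twirl

section PermSum

variable {d : Type*} [DecidableEq d] {α : Type*} [DecidableEq α] {n : ℕ}

/-- The group-algebra element `∑ π, tr_d(π) π` acting on `n` copies of `α`. -/
def permTraceSum (d α : Type*) [Fintype d] [DecidableEq d] [DecidableEq α] (n : ℕ) :
    Matrix (Fin n → α) (Fin n → α) ℂ :=
  Matrix.of fun v w => ∑ π : Equiv.Perm (Fin n), permTrace d π * if w = v ∘ π then 1 else 0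

/-- The sum of the permutations of the tensor factors that fix `y`. -/
def stabilizerSum (α : Type*) [DecidableEq α] (y : Fin n → d) :
    Matrix (Fin n → α) (Fin n → α) ℂ :=
  Matrix.of fun v w => ∑ π : Equiv.Perm (Fin n),
    (if y = y ∘ π then 1 else 0) * if w = v ∘ π then 1 else 0

lemma permTraceSum_eq_sum [Fintype d] : permTraceSum d α n = ∑ y : Fin n → d, stabilizerSum α y := by
  ext v w
  simp only [permTraceSum, permTrace, stabilizerSum, Matrix.of_apply, Matrix.sum_apply,
    Finset.sum_mul]
  exact Finset.sum_comm

lemma eq_comp_perm_iff {β : Type*} (f g : Fin n → β) (π : Equiv.Perm (Fin n)) :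
    f = g ∘ π ↔ g = f ∘ ⇑π⁻¹ :=
  ⟨fun h => by ext i; simp [h], fun h => by ext i; simp [h]⟩

lemma stabilizerSum_isHermitian (y : Fin n → d) : (stabilizerSum α y).IsHermitian := by
  ext v w
  simp only [stabilizerSum, Matrix.conjTranspose_apply, Matrix.of_apply, star_sum, star_mul']
  refine Fintype.sum_equiv (Equiv.inv _) _ _ fun π => ?_
  rw [Equiv.inv_apply, if_congr (eq_comp_perm_iff y y π) rfl rfl,
    if_congr (eq_comp_perm_iff v w π) rfl rfl]
  simp [apply_ite (starRingEnd ℂ)]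

lemma mul_sum_perm [Fintype α] (A : Matrix (Fin n → α) (Fin n → α) ℂ) (c : Equiv.Perm (Fin n) → ℂ)
    (v w : Fin n → α) :
    (A * Matrix.of fun v w : Fin n → α => ∑ π : Equiv.Perm (Fin n),
      c π * if w = v ∘ π then 1 else 0) v w = ∑ π, c π * A v (w ∘ ⇑π⁻¹) := by
  simp only [Matrix.mul_apply, Matrix.of_apply, Finset.mul_sum]
  rw [Finset.sum_comm]
  refine Finset.sum_congr rfl fun π _ => ?_
  rw [Finset.sum_eq_single (w ∘ ⇑π⁻¹)]
  · have : w = (w ∘ ⇑π⁻¹) ∘ ⇑π := by ext i; simp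
    rw [← this]; simp [mul_comm]
  · intro u _ hu
    have : w ≠ u ∘ π := by rintro rfl; exact hu (by ext i; simp)
    simp [this]
  · simp

lemma stabilizerSum_comp {y : Fin n → d} {π : Equiv.Perm (Fin n)} (hπ : y = y ∘ π)
    (v w : Fin n → α) : stabilizerSum α y v (w ∘ π) = stabilizerSum α y v w := by
  simp only [stabilizerSum, Matrix.of_apply]
  refine Fintype.sum_equiv (Equiv.mulRight π⁻¹) _ _ fun σ => ?_
  have h1 : w ∘ π = v ∘ σ ↔ w = v ∘ ⇑(σ * π⁻¹) :=
    ⟨fun h => by ext i; simpa using congrFun h (π⁻¹ i),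
      fun h => by ext i; simp [h]⟩
  have h2 : y = y ∘ σ ↔ y = y ∘ ⇑(σ * π⁻¹) := by
    constructor
    · intro h; ext i
      have h3 := congrFun h (π⁻¹ i)
      have h4 := congrFun hπ (π⁻¹ i)
      simp at h3 h4 ⊢
      rw [← h3, h4]
    · intro h; ext i
      have h3 := congrFun h (π i)
      have h4 := congrFun hπ i
      simp at h3 h4 ⊢
      rw [← h3, h4]
  exact congrArg₂ (· * ·) (if_congr h2 rfl rfl) (if_congr h1 rfl rfl)

lemma stabilizerSum_mul_self [Fintype α] (y : Fin n → d) :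
    stabilizerSum α y * stabilizerSum α y =
      (Fintype.card {π : Equiv.Perm (Fin n) // y = y ∘ π} : ℂ) • stabilizerSum α y := by
  ext v w
  have h := mul_sum_perm (stabilizerSum α y) (fun π => if y = y ∘ π then 1 else 0) v w
  rw [← stabilizerSum] at h
  rw [h, Matrix.smul_apply, Fintype.card_subtype, ← Finset.sum_boole, smul_eq_mul, Finset.sum_mul]
  refine Finset.sum_congr rfl fun π _ => ?_
  split_ifs with hπ
  · rw [← stabilizerSum_comp hπ, Function.comp_assoc]
    congr 2
    ext i; simp
  · simp

lemma stabilizerSum_posSemidef [Fintype α] (y : Fin n → d) : (stabilizerSum α y).PosSemidef := by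
  have hne : Nonempty {π : Equiv.Perm (Fin n) // y = y ∘ π} := ⟨⟨1, rfl⟩⟩
  have hc : (Fintype.card {π : Equiv.Perm (Fin n) // y = y ∘ π} : ℂ) ≠ 0 := by
    simp [Fintype.card_ne_zero]
  have h : stabilizerSum α y = (Fintype.card {π : Equiv.Perm (Fin n) // y = y ∘ π} : ℂ)⁻¹ •
      ((stabilizerSum α y)ᴴ * stabilizerSum α y) := by
    rw [(stabilizerSum_isHermitian y).eq, stabilizerSum_mul_self, smul_smul, inv_mul_cancel₀ hc,
      one_smul]
  rw [h]
  exact (posSemidef_conjTranspose_mul_self _).smul (by positivity)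

lemma permTraceSum_posDef [Fintype d] [Fintype α] {e : α → d} (he : Function.Injective e) :
    (permTraceSum d α n).PosDef := by
  rw [permTraceSum_eq_sum]
  have hpsd := posSemidef_sum Finset.univ fun (y : Fin n → d) _ =>
    stabilizerSum_posSemidef (α := α) y
  refine PosDef.of_dotProduct_mulVec_pos hpsd.1 fun x hx =>
    lt_of_le_of_ne (hpsd.dotProduct_mulVec_nonneg x) fun h0 => hx ?_
  rw [Matrix.sum_mulVec, dotProduct_sum, eq_comm, Finset.sum_eq_zero_iff_of_nonneg
    fun y _ => (stabilizerSum_posSemidef y).dotProduct_mulVec_nonneg x] at h0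
  ext v
  have h := ((stabilizerSum_posSemidef (e ∘ v)).dotProduct_mulVec_zero_iff x).mp
    (h0 (e ∘ v) (Finset.mem_univ _))
  have hv := congrFun h v
  simp only [Matrix.mulVec, dotProduct, stabilizerSum, Matrix.of_apply, Finset.sum_mul,
    Pi.zero_apply] at hv
  rw [Finset.sum_comm] at hv
  have hterm : ∀ π : Equiv.Perm (Fin n), ∑ w, ((if e ∘ v = (e ∘ v) ∘ π then (1 : ℂ) else 0) *
      if w = v ∘ π then 1 else 0) * x w = if e ∘ v = (e ∘ v) ∘ π then x v else 0 := by
    intro π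
    split_ifs with hπ
    · have : v = v ∘ π := he.comp_left hπ
      rw [← this]
      simp
    · simp
  simp only [hterm] at hv
  rw [← Finset.sum_filter, Finset.sum_const, smul_eq_zero, Finset.card_eq_zero,
    Finset.filter_eq_empty_iff] at hv
  exact hv.resolve_left fun h => h (Finset.mem_univ 1) rfl

end PermSum

section Main

lemma kronWithId_eq_submatrix {dA dR n : ℕ} (κ : Matrix (Fin n → Fin dA) (Fin n → Fin dA) ℂ) :
    kronWithId (dR := dR) κ = (Matrix.kroneckerMap (· * ·) κ 1).submatrix
      (Equiv.arrowProdEquivProdArrow (Fin n) (fun _ => Fin dA) (fun _ => Fin dR))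
      (Equiv.arrowProdEquivProdArrow (Fin n) (fun _ => Fin dA) (fun _ => Fin dR)) := by
  ext v w
  simp [kronWithId, Matrix.one_apply, Equiv.arrowProdEquivProdArrow]

lemma kronWithId_mul {dA dR n : ℕ} (κ₁ κ₂ : Matrix (Fin n → Fin dA) (Fin n → Fin dA) ℂ) :
    kronWithId (dR := dR) κ₁ * kronWithId κ₂ = kronWithId (κ₁ * κ₂) := by
  simp only [kronWithId_eq_submatrix, Matrix.submatrix_mul_equiv]
  rw [← Matrix.mul_kronecker_mul, mul_one]

lemma kronWithId_one {dA dR n : ℕ} :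
    kronWithId (dR := dR) (1 : Matrix (Fin n → Fin dA) (Fin n → Fin dA) ℂ) = 1 := by
  simp only [kronWithId_eq_submatrix]
  rw [Matrix.one_kronecker_one, Matrix.submatrix_one_equiv]

lemma kronWithId_smul {dA dR n : ℕ} (c : ℂ) (κ : Matrix (Fin n → Fin dA) (Fin n → Fin dA) ℂ) :
    kronWithId (dR := dR) (c • κ) = c • kronWithId κ := by
  ext v w
  simp [kronWithId]

lemma kronWithId_posSemidef {dA dR n : ℕ} {κ : Matrix (Fin n → Fin dA) (Fin n → Fin dA) ℂ}
    (hκ : κ.PosSemidef) : (kronWithId (dR := dR) κ).PosSemidef := by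
  rw [kronWithId_eq_submatrix]
  exact (hκ.kronecker PosSemidef.one).submatrix _

lemma symProj_apply {d : Type*} [DecidableEq d] {n : ℕ} (v w : Fin n → d) :
    symProj d n v w =
      (∑ π : Equiv.Perm (Fin n), if w = v ∘ π then 1 else 0) / (n.factorial : ℂ) := by
  rw [symProj, Matrix.of_apply, Fintype.card_subtype, Finset.sum_boole]

lemma symProj_isHermitian (d : Type*) [DecidableEq d] (n : ℕ) : (symProj d n).IsHermitian := by
  ext v w
  simp only [Matrix.conjTranspose_apply, symProj_apply, star_div₀, star_sum, star_natCast]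
  congr 1
  refine Fintype.sum_equiv (Equiv.inv _) _ _ fun π => ?_
  rw [Equiv.inv_apply, if_congr (eq_comp_perm_iff v w π) rfl rfl]
  simp [apply_ite (starRingEnd ℂ)]

open scoped MatrixOrder in
/-- A matrix commuting with a positive semidefinite `K` can be sandwiched by a square root. -/
lemma exists_posSemidef_sqrt_mul_eq {ι : Type*} [Fintype ι] [DecidableEq ι] {K P : Matrix ι ι ℂ}
    (hK : K.PosSemidef) (h : Commute K P) :
    ∃ S : Matrix ι ι ℂ, S.PosSemidef ∧ S * S = K ∧ P * K = S * P * S := by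
  have hK0 : 0 ≤ K := nonneg_iff_posSemidef.mpr hK
  have hS := CFC.sqrt_mul_sqrt_self K hK0
  refine ⟨CFC.sqrt K, nonneg_iff_posSemidef.mp (CFC.sqrt_nonneg K), hS, ?_⟩
  have hc : Commute (CFC.sqrt K) P := by
    rw [CFC.sqrt_eq_cfc]
    exact h.cfc_nnreal _
  rw [hc.eq, mul_assoc, hS]

lemma mul_kronWithId_permTraceSum {n dA dR : ℕ} (h : dA ≤ dR)
    [MeasurableSpace (Matrix.unitaryGroup (Fin dR) ℂ)]
    [BorelSpace (Matrix.unitaryGroup (Fin dR) ℂ)]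
    (μ : Measure (Matrix.unitaryGroup (Fin dR) ℂ))
    [μ.IsMulLeftInvariant] [IsProbabilityMeasure μ]
    {T : Matrix (Fin n → Fin dA × Fin dR) (Fin n → Fin dA × Fin dR) ℂ}
    (hT : ∀ v w, T v w = ∫ U, outer (vecPow (twistedVec h U) n) v w ∂μ) :
    T * kronWithId (permTraceSum (Fin dR) (Fin dA) n) =
      (n.factorial : ℂ) • symProj (Fin dA × Fin dR) n := by
  have hT' : ∀ v w, T v w = twirl μ (fun i => Fin.castLE h (v i).1)
      (fun i => Fin.castLE h (w i).1) (fun i => (v i).2) fun i => (w i).2 := hT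
  ext v w
  rw [Matrix.smul_apply, symProj_apply, smul_eq_mul,
    mul_div_cancel₀ _ (Nat.cast_ne_zero.mpr n.factorial_ne_zero)]
  simp only [Matrix.mul_apply, kronWithId, permTraceSum, Matrix.of_apply, Finset.sum_mul,
    Finset.mul_sum]
  rw [Finset.sum_comm]
  trans ∑ π : Equiv.Perm (Fin n), permTrace (Fin dR) π *
      twirl μ (fun i => Fin.castLE h (v i).1) (fun i => Fin.castLE h (w i).1)
        (fun i => (v i).2) ((fun i => (w i).2) ∘ π)
  · refine Finset.sum_congr rfl fun π _ => ?_
    rw [Finset.sum_eq_single fun i => ((w (π⁻¹ i)).1, (w i).2)]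
    · rw [hT', ← twirl_comp_perm _ _ _ _ _ π]
      simp [mul_comm, Function.comp_def]
    · intro u _ hu
      by_cases h1 : (fun i => (w i).1) = (fun i => (u i).1) ∘ π
      · have h2 : (fun i => (u i).2) ≠ fun i => (w i).2 := by
          intro h2
          refine hu (funext fun i => Prod.ext ?_ (congrFun h2 i))
          simpa using (congrFun h1 (π⁻¹ i)).symm
        simp [h2]
      · simp [h1]
    · simp
  · rw [sum_permTrace_mul_twirl]
    refine Fintype.sum_equiv (Equiv.inv _) _ _ fun π => ?_
    rw [ite_zero_mul_ite_zero, one_mul]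
    congr 1
    rw [eq_iff_iff]
    constructor
    · rintro ⟨h1, h2⟩
      ext i : 1
      have h3 := congrFun h1 (π⁻¹ i)
      have h4 := congrFun h2 (π⁻¹ i)
      simp at h3 h4
      exact Prod.ext (by simp [h4]) (by simp [h3])
    · rintro rfl
      constructor <;> ext i <;> simp

end Main



/-- **Appendix Lemma (structure of the Haar-twirled maximally entangled state).**
`T_n = S · P_sym · S` where `S` is the positive semidefinite square root of `κ ⊠ 1`
for some positive definite `κ` on the `A`-systems. -/
theorem haar_twirl_structure (n dA dR : ℕ) (hn : 0 < n) (hdA : 0 < dA) (hdR : 0 < dR)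
    (h : dA ≤ dR)
    [MeasurableSpace (Matrix.unitaryGroup (Fin dR) ℂ)]
    [BorelSpace (Matrix.unitaryGroup (Fin dR) ℂ)]
    (μ : Measure (Matrix.unitaryGroup (Fin dR) ℂ))
    [μ.IsHaarMeasure] [IsProbabilityMeasure μ]
    (T : Matrix (Fin n → Fin dA × Fin dR) (Fin n → Fin dA × Fin dR) ℂ)
    (hT : ∀ v w, T v w = ∫ U, outer (vecPow (twistedVec h U) n) v w ∂μ) :
    ∃ κ : Matrix (Fin n → Fin dA) (Fin n → Fin dA) ℂ, κ.PosDef ∧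
      ∃ S : Matrix (Fin n → Fin dA × Fin dR) (Fin n → Fin dA × Fin dR) ℂ,
        S.PosSemidef ∧ S * S = kronWithId κ ∧
        T = S * symProj (Fin dA × Fin dR) n * S := by
  have hfact : (n.factorial : ℂ) ≠ 0 := Nat.cast_ne_zero.mpr n.factorial_ne_zero
  have hZ : (permTraceSum (Fin dR) (Fin dA) n).PosDef :=
    permTraceSum_posDef (Fin.castLE_injective h)
  set κ := (n.factorial : ℂ) • (permTraceSum (Fin dR) (Fin dA) n)⁻¹ with hκ_def
  have hκ : κ.PosDef := hZ.inv.smul (by exact_mod_cast n.factorial_pos)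
  have hTκ : T = symProj (Fin dA × Fin dR) n * kronWithId κ := by
    rw [hκ_def, kronWithId_smul, Matrix.mul_smul, ← Matrix.smul_mul,
      ← mul_kronWithId_permTraceSum h μ hT, mul_assoc, kronWithId_mul,
      Matrix.mul_nonsing_inv _ ((Matrix.isUnit_iff_isUnit_det _).mp hZ.isUnit), kronWithId_one,
      mul_one]
  have hTH : T.IsHermitian := by
    ext v w
    rw [Matrix.conjTranspose_apply, hT, hT, ← starRingEnd_apply, ← integral_conj]
    simp [outer, mul_comm]
  have hK : (kronWithId (dR := dR) κ).PosSemidef := kronWithId_posSemidef hκ.posSemidef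
  have hcomm : Commute (kronWithId κ) (symProj (Fin dA × Fin dR) n) := by
    have := hTH.eq
    rwa [hTκ, Matrix.conjTranspose_mul, hK.1.eq, (symProj_isHermitian _ _).eq] at this
  obtain ⟨S, hS, hSS, hPS⟩ := exists_posSemidef_sqrt_mul_eq hK hcomm
  exact ⟨κ, hκ, S, hS, hSS, hTκ.trans hPS⟩

end
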